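/- Let C be a convex body in ℝⁿ with 0 in its interior, and let f : int C → ℝ_{>0} be a log-concave function with ∫_C f(x)·x dx = 0, such that ∇f(x) exists almost everywhere on int C and ∫_C ⟨x, ∇f(x)⟩ dx exists. Then ∫_C ⟨x, ∇f(x)⟩ dx = 0 holds if and only if there exist c ∈ ℝⁿ and γ ∈ ℝ_{>0} such that f(x) = γ·e^{⟨c,x⟩} for all x ∈ int C. -/

import Mathlib

open MeasureTheory
open scoped ENNReal RealInnerProductSpace Classical

/-- A continuous concave function on an open set has a supergradient at every point. -/
theorem ConcaveOn.exists_supergradient {E : Type*} [NormedAddCommGroup E] [NormedSpace ℝ E]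
    {s : Set E} {g : E → ℝ} (hg : ConcaveOn ℝ s g) (hs : IsOpen s) (hc : ContinuousOn g s)
    {a : E} (ha : a ∈ s) : ∃ L : E →L[ℝ] ℝ, ∀ x ∈ s, g x ≤ g a + L (x - a) := by
  have hopen : IsOpen {p : E × ℝ | p.1 ∈ s ∧ p.2 < g p.1} := by
    have hc' : ContinuousOn (fun p : E × ℝ => g p.1 - p.2) (Prod.fst ⁻¹' s) :=
      (hc.comp continuousOn_fst fun _ hp => hp).sub continuousOn_snd
    have := hc'.isOpen_inter_preimage (hs.preimage continuous_fst) (isOpen_Ioi (a := (0 : ℝ)))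
    convert this using 1
    ext p
    simp
  obtain ⟨F, hF⟩ := geometric_hahn_banach_open_point (x := (a, g a))
    hg.convex_strict_hypograph hopen fun h => lt_irrefl _ h.2
  have hsplit : ∀ x t, F (x, t) = F (x, 0) + t * F (0, 1) := fun x t => by
    rw [← smul_eq_mul, ← map_smul, ← map_add]
    simp
  have hb : 0 < F (0, 1) := by
    have h := hF (a, g a - 1) ⟨ha, by simp⟩
    rw [hsplit a (g a - 1), hsplit a (g a)] at h
    linarith
  refine ⟨-(F (0, 1))⁻¹ • F.comp (ContinuousLinearMap.inl ℝ E ℝ), fun x hx => ?_⟩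
  have key : F (x, 0) + g x * F (0, 1) ≤ F (a, 0) + g a * F (0, 1) := by
    refine le_of_forall_pos_lt_add fun ε hε => ?_
    have h := hF (x, g x - ε / F (0, 1)) ⟨hx, by simpa using div_pos hε hb⟩
    rw [hsplit x, hsplit a (g a), sub_mul, div_mul_cancel₀ _ hb.ne'] at h
    linarith
  have hsub : F (x - a, 0) = F (x, 0) - F (a, 0) := by
    rw [← map_sub]
    simp
  simp only [smul_apply, ContinuousLinearMap.comp_apply,
    ContinuousLinearMap.inl_apply, smul_eq_mul, hsub]
  have hle := mul_le_mul_of_nonneg_left key (inv_pos.2 hb).le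
  have hcancel : ∀ t, (F (0, 1))⁻¹ * (t * F (0, 1)) = t := fun t => by field_simp
  rw [mul_add, mul_add, hcancel, hcancel] at hle
  linarith

/-- A concave function lies below its first-order approximation at a point of
differentiability. -/
theorem ConcaveOn.le_add_fderiv {E : Type*} [NormedAddCommGroup E] [NormedSpace ℝ E]
    {s : Set E} {g : E → ℝ} (hg : ConcaveOn ℝ s g) {x y : E} (hx : x ∈ s) (hy : y ∈ s)
    {g' : E →L[ℝ] ℝ} (h : HasFDerivAt g g' x) : g y ≤ g x + g' (y - x) := by
  have hline : HasDerivAt (fun t : ℝ => g (AffineMap.lineMap x y t)) (g' (y - x)) 0 := by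
    refine HasFDerivAt.comp_hasDerivAt 0 ?_ AffineMap.hasDerivAt_lineMap
    simpa using h
  have := (hg.comp_affineMap (AffineMap.lineMap (k := ℝ) x y)).slope_le_of_hasDerivAt
    (x := 0) (y := 1) (by simpa using hx) (by simpa using hy) one_pos hline
  simp only [slope_def_field, Function.comp_apply, AffineMap.lineMap_apply_one,
    AffineMap.lineMap_apply_zero] at this
  linarith

/-- The logarithm of a positive log-concave function is concave. -/
theorem concaveOn_log_of_rpow_mul_rpow_le {E : Type*} [AddCommGroup E] [Module ℝ E]
    {s : Set E} (hs : Convex ℝ s) {f : E → ℝ} (hf : ∀ x ∈ s, 0 < f x)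
    (hlc : ∀ x ∈ s, ∀ y ∈ s, ∀ l : ℝ, l ∈ Set.Icc (0 : ℝ) 1 →
      f x ^ (1 - l) * f y ^ l ≤ f ((1 - l) • x + l • y)) :
    ConcaveOn ℝ s fun x => Real.log (f x) := by
  refine ⟨hs, fun x hx y hy a b ha hb hab => ?_⟩
  obtain rfl : a = 1 - b := by linarith
  have hxp := Real.rpow_pos_of_pos (hf x hx) (1 - b)
  have hyp := Real.rpow_pos_of_pos (hf y hy) b
  have h := Real.log_le_log (mul_pos hxp hyp) (hlc x hx y hy b ⟨hb, by linarith⟩)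
  rwa [Real.log_mul hxp.ne' hyp.ne', Real.log_rpow (hf x hx), Real.log_rpow (hf y hy)] at h

/-- Equality case: for a log-concave positive function `f` on the interior of a
convex body `C` with vanishing first moment, `∫_C ⟨x, ∇f(x)⟩ dx = 0` holds if and
only if `f(x) = γ·e^{⟨c,x⟩}` on the interior of `C`. -/
theorem logconcave_moment_gradient_eq_zero_iff
    (n : ℕ) (C : Set (EuclideanSpace ℝ (Fin n)))
    (hCconv : Convex ℝ C) (hCcpt : IsCompact C)
    (h0 : 0 ∈ interior C)
    (f : EuclideanSpace ℝ (Fin n) → ℝ)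
    (hfpos : ∀ x ∈ interior C, 0 < f x)
    (hflc : ∀ x ∈ interior C, ∀ y ∈ interior C, ∀ l : ℝ, l ∈ Set.Icc (0 : ℝ) 1 →
      f x ^ (1 - l) * f y ^ l ≤ f ((1 - l) • x + l • y))
    (hmom : (∫ x in C, f x • x) = 0)
    (hdiff : ∀ᵐ x ∂(volume.restrict (interior C)), DifferentiableAt ℝ f x)
    (hint : IntegrableOn (fun x => ⟪x, gradient f x⟫) C) :
    (∫ x in C, ⟪x, gradient f x⟫) = 0
      ↔ ∃ (c : EuclideanSpace ℝ (Fin n)) (γ : ℝ), 0 < γ ∧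
          ∀ x ∈ interior C, f x = γ * Real.exp ⟪c, x⟫ := by
  have hrestr : volume.restrict C = volume.restrict (interior C) :=
    (Measure.restrict_congr_set
      (interior_ae_eq_of_null_frontier (hCconv.addHaar_frontier volume))).symm
  unfold IntegrableOn at hint
  rw [hrestr] at hmom hint ⊢
  have hopen : IsOpen (interior C) := isOpen_interior
  have hmeas : MeasurableSet (interior C) := hopen.measurableSet
  have hg := concaveOn_log_of_rpow_mul_rpow_le hCconv.interior hfpos hflc
  have hgc : ContinuousOn (fun x => Real.log (f x)) (interior C) := hg.continuousOn hopen
  have hfexp : ∀ x ∈ interior C, f x = Real.exp (Real.log (f x)) := fun x hx =>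
    (Real.exp_log (hfpos x hx)).symm
  have hfc : ContinuousOn f (interior C) := hgc.rexp.congr hfexp
  obtain ⟨v, hv⟩ : ∃ v : EuclideanSpace ℝ (Fin n), ∀ x ∈ interior C,
      Real.log (f x) ≤ Real.log (f 0) + ⟪v, x⟫ := by
    obtain ⟨L, hL⟩ := hg.exists_supergradient hopen hgc h0
    exact ⟨(InnerProductSpace.toDual ℝ _).symm L, fun x hx => by simpa using hL x hx⟩
  have hmomint : Integrable (fun x => f x • x) (volume.restrict (interior C)) := by
    have hbound : IntegrableOn (fun x : EuclideanSpace ℝ (Fin n) =>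
        Real.exp (Real.log (f 0) + ⟪v, x⟫) * ‖x‖) (interior C) :=
      ((by fun_prop : Continuous _).continuousOn.integrableOn_compact hCcpt).mono_set
        interior_subset
    refine hbound.mono' ((hfc.smul continuousOn_id).aestronglyMeasurable hmeas) ?_
    filter_upwards [ae_restrict_mem hmeas] with x hx
    rw [norm_smul, Real.norm_of_nonneg (hfpos x hx).le]
    gcongr
    rw [hfexp x hx]
    exact Real.exp_le_exp.2 (hv x hx)
  have hinner : ∀ w : EuclideanSpace ℝ (Fin n),
      Integrable (fun x => ⟪w, f x • x⟫) (volume.restrict (interior C)) ∧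
      (∫ x in interior C, ⟪w, f x • x⟫) = 0 := fun w =>
    ⟨hmomint.const_inner w, by rw [integral_inner hmomint, hmom, inner_zero_right]⟩
  constructor
  · intro hzero
    have hsandwich : ∀ᵐ x ∂(volume.restrict (interior C)),
        ⟪x, gradient f x⟫ ≤ f x * (Real.log (f x) - Real.log (f 0)) ∧
          f x * (Real.log (f x) - Real.log (f 0)) ≤ ⟪v, f x • x⟫ := by
      filter_upwards [hdiff, ae_restrict_mem hmeas] with x hdx hx
      have hfx := hfpos x hx
      constructor
      · have h := hg.le_add_fderiv hx h0 (hdx.hasGradientAt.hasFDerivAt.log hfx.ne')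
        simp only [zero_sub, map_neg, smul_apply,
          InnerProductSpace.toDual_apply_apply, smul_eq_mul] at h
        have hle := mul_le_mul_of_nonneg_left h hfx.le
        rw [mul_add, mul_neg, mul_inv_cancel_left₀ hfx.ne'] at hle
        rw [real_inner_comm]
        linarith
      · rw [real_inner_smul_right]
        gcongr
        linarith [hv x hx]
    have hae : (fun x => ⟪x, gradient f x⟫) =ᵐ[volume.restrict (interior C)]
        fun x => ⟪v, f x • x⟫ := by
      refine (integral_eq_iff_of_ae_le hint (hinner v).1 ?_).1 ?_
      · filter_upwards [hsandwich] with x hx using hx.1.trans hx.2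
      · rw [hzero, (hinner v).2]
    have hlog : (fun x => Real.log (f x)) =ᵐ[volume.restrict (interior C)]
        fun x => Real.log (f 0) + ⟪v, x⟫ := by
      filter_upwards [hsandwich, hae, ae_restrict_mem hmeas] with x hx hxe hxC
      have h := le_antisymm hx.2 (hxe ▸ hx.1)
      rw [real_inner_smul_right] at h
      linarith [mul_left_cancel₀ (hfpos x hxC).ne' h]
    have heq := Measure.eqOn_open_of_ae_eq hlog hopen hgc (by fun_prop)
    refine ⟨v, f 0, hfpos 0 h0, fun x hx => ?_⟩
    have hx' : Real.log (f x) = Real.log (f 0) + ⟪v, x⟫ := heq hx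
    rw [hfexp x hx, hx', Real.exp_add, Real.exp_log (hfpos 0 h0)]
  · rintro ⟨c, γ, -, hf⟩
    rw [← (hinner c).2]
    refine setIntegral_congr_fun hmeas fun x hx => ?_
    have hexp : HasFDerivAt (fun y : EuclideanSpace ℝ (Fin n) => γ * Real.exp ⟪c, y⟫)
        (γ • Real.exp ⟪c, x⟫ • innerSL ℝ c) x :=
      ((innerSL ℝ c).hasFDerivAt.exp).const_mul γ
    have hfx : HasGradientAt f (f x • c) x := by
      rw [hasGradientAt_iff_hasFDerivAt]
      refine (hexp.congr_of_eventuallyEq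
        (Filter.eventually_of_mem (hopen.mem_nhds hx) hf)).congr_fderiv ?_
      ext y
      simp [hf x hx, mul_assoc]
    simp only [hfx.gradient, real_inner_smul_right]
    rw [real_inner_comm]
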